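/- Let J(t) = (1/d!) · D^{n-d}[t^{n-d}(1+t)^d] and let λ be its largest root. Then J'(λ) ≥ n^{-d(n-d)}. -/

import Mathlib

open Polynomial

lemma Polynomial.Splits.derivative_real {p : ℝ[X]} (hp : p.Splits) : (derivative p).Splits := by
  rw [splits_iff_card_roots] at hp ⊢
  have h₁ := card_roots_le_derivative p
  have h₂ := natDegree_derivative_le p
  have h₃ := card_roots' (derivative p)
  omega

lemma Polynomial.Splits.iterate_derivative_real {p : ℝ[X]} (hp : p.Splits) (k : ℕ) :
    (derivative^[k] p).Splits := by
  induction k with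
  | zero => exact hp
  | succ k ih => rw [Function.iterate_succ_apply']; exact ih.derivative_real

/-- A root of a solution of a second order linear differential equation is simple wherever the
leading coefficient of the equation does not vanish. -/
lemma Polynomial.eval_derivative_ne_zero_of_ode {J a b c : ℝ[X]} {x : ℝ} (hJ : J ≠ 0)
    (ode : a * derivative (derivative J) + b * derivative J + c * J = 0)
    (ha : a.eval x ≠ 0) (hx : J.IsRoot x) : (derivative J).eval x ≠ 0 := by
  intro hx'
  have h₁ : (derivative J).rootMultiplicity x = J.rootMultiplicity x - 1 :=
    derivative_rootMultiplicity_of_root hx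
  have h₂ : (derivative (derivative J)).rootMultiplicity x =
      (derivative J).rootMultiplicity x - 1 := derivative_rootMultiplicity_of_root hx'
  have hlt : 1 < J.rootMultiplicity x := (one_lt_rootMultiplicity_iff_isRoot hJ).2 ⟨hx, hx'⟩
  have ne_zero_of_root : ∀ p : ℝ[X], p ≠ 0 → p.IsRoot x → derivative p ≠ 0 := by
    intro p hp hpx h
    have hC := eq_C_of_natDegree_eq_zero (derivative_eq_zero.1 h)
    have h0 : p.coeff 0 = 0 := by
      rw [hC] at hpx
      simpa only [IsRoot.def, eval_C] using hpx
    exact hp (by rw [hC, h0, C_0])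
  have hJ₁ := ne_zero_of_root J hJ hx
  have hJ₂ := ne_zero_of_root _ hJ₁ hx'
  have hcop : IsCoprime ((X - C x) ^ (J.rootMultiplicity x - 1)) a := by
    refine IsCoprime.pow_left ?_
    rw [(irreducible_X_sub_C x).coprime_iff_not_dvd, dvd_iff_isRoot]
    exact ha
  have hdvd : (X - C x) ^ (J.rootMultiplicity x - 1) ∣ a * derivative (derivative J) := by
    have e : a * derivative (derivative J) = -(b * derivative J + c * J) := by
      linear_combination ode
    rw [e, dvd_neg]
    refine dvd_add (Dvd.dvd.mul_left ?_ _) (Dvd.dvd.mul_left ?_ _)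
    · rw [← h₁]; exact pow_rootMultiplicity_dvd _ _
    · exact (pow_dvd_pow _ (Nat.sub_le _ _)).trans (pow_rootMultiplicity_dvd _ _)
  have := (le_rootMultiplicity_iff hJ₂).2 (hcop.dvd_of_dvd_mul_left hdvd)
  omega

/-- A form of the inequality between the arithmetic and the geometric mean. -/
lemma Multiset.prod_inv_le_exp (R : Multiset ℝ) {K : ℝ} (hK : 0 < K) (hR : ∀ r ∈ R, 0 < r) :
    1 ≤ K ^ R.card * R.prod * Real.exp ((R.map fun r ↦ 1 / r).sum / K - R.card) := by
  induction R using Multiset.induction_on with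
  | empty => simp
  | cons r R ih =>
    have hr : 0 < r := hR r (by simp)
    have h₁ := ih fun s hs ↦ hR s (by simp [hs])
    have h₂ : 1 ≤ K * r * Real.exp (1 / r / K - 1) := by
      have h := Real.add_one_le_exp (1 / r / K - 1)
      calc (1 : ℝ) = K * r * (1 / r / K - 1 + 1) := by field_simp; ring
        _ ≤ _ := by gcongr
    calc (1 : ℝ) ≤ (K * r * Real.exp (1 / r / K - 1)) *
          (K ^ R.card * R.prod * Real.exp ((R.map fun r ↦ 1 / r).sum / K - R.card)) :=
          one_le_mul_of_one_le_of_one_le h₂ h₁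
      _ = _ := by
          simp only [Multiset.card_cons, Multiset.prod_cons, Multiset.map_cons, Multiset.sum_cons]
          have e : (1 / r + (R.map fun r ↦ 1 / r).sum) / K - ((R.card + 1 : ℕ) : ℝ) =
              (1 / r / K - 1) + ((R.map fun r ↦ 1 / r).sum / K - R.card) := by
            push_cast; ring
          rw [e, Real.exp_add]
          ring

lemma Multiset.one_le_pow_card_mul_prod (R : Multiset ℝ) {K : ℝ} (hK : 0 < K)
    (hR : ∀ r ∈ R, 0 < r) (h : (R.map fun r ↦ 1 / r).sum ≤ K * R.card) :
    1 ≤ K ^ R.card * R.prod := by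
  have hprod : 0 ≤ R.prod := Multiset.prod_nonneg fun r hr ↦ (hR r hr).le
  refine (R.prod_inv_le_exp hK hR).trans (mul_le_of_le_one_right (by positivity) ?_)
  rw [Real.exp_le_one_iff, sub_nonpos, div_le_iff₀ hK]
  linarith

lemma Nat.factorial_succ_le_pow (k : ℕ) : (k + 1).factorial ≤ (k + 1) ^ k := by
  induction k with
  | zero => simp
  | succ k ih =>
    rw [Nat.factorial_succ, pow_succ, mul_comm]
    gcongr
    exact ih.trans (Nat.pow_le_pow_left (by omega) _)

/-- The polynomial `(1/d!) · D^m[t^m(1+t)^d]`. -/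
noncomputable def jacobiPoly (d m : ℕ) : ℝ[X] :=
  (1 / (d.factorial : ℝ)) • derivative^[m] ((X : ℝ[X]) ^ m * (1 + X) ^ d)

namespace jacobiPoly

variable (d m : ℕ)

lemma coeff_eq (j : ℕ) :
    (jacobiPoly d m).coeff j = (j + m).descFactorial m * d.choose j / d.factorial := by
  rw [jacobiPoly, coeff_smul, coeff_iterate_derivative, add_comm j m, add_comm m j,
    coeff_X_pow_mul, coeff_one_add_X_pow]
  simp only [nsmul_eq_mul, smul_eq_mul]
  ring

lemma coeff_succ (j : ℕ) :
    ((j : ℝ) + 1) ^ 2 * (jacobiPoly d m).coeff (j + 1) =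
      ((d : ℝ) - j) * (m + j + 1) * (jacobiPoly d m).coeff j := by
  have h₁ : ((j : ℝ) + 1) * (j + 1 + m).descFactorial m =
      (m + j + 1) * (j + m).descFactorial m := by
    have h := Nat.succ_descFactorial (j + m) m
    rw [show j + m + 1 - m = j + 1 by omega, show j + m + 1 = j + 1 + m by omega] at h
    have h' := congrArg (Nat.cast (R := ℝ)) h
    push_cast at h'
    linear_combination h'
  have h₂ : ((j : ℝ) + 1) * d.choose (j + 1) = (d - j) * d.choose j := by
    have h := Nat.choose_succ_right_eq d j
    rcases le_or_gt j d with hj | hj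
    · have h' := congrArg (Nat.cast (R := ℝ)) h
      push_cast [hj] at h'
      linear_combination h'
    · simp [Nat.choose_eq_zero_of_lt hj, Nat.choose_eq_zero_of_lt (hj.trans (Nat.lt_succ_self j))]
  rw [coeff_eq, coeff_eq]
  linear_combination (d.choose (j + 1) * ((j : ℝ) + 1) / d.factorial) * h₁ +
    ((m + j + 1) * (j + m).descFactorial m / d.factorial : ℝ) * h₂

lemma ode :
    (X * (1 + X)) * derivative (derivative (jacobiPoly d m)) +
      (1 + C ((m : ℝ) + 2 - d) * X) * derivative (jacobiPoly d m) +
      C (-(d * (m + 1)) : ℝ) * jacobiPoly d m = 0 := by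
  have e : ∀ p : ℝ[X], (X * (1 + X)) * derivative (derivative p) +
      (1 + C ((m : ℝ) + 2 - d) * X) * derivative p + C (-(d * (m + 1)) : ℝ) * p =
      X * derivative (derivative p) + X * (X * derivative (derivative p)) + derivative p +
      C ((m : ℝ) + 2 - d) * (X * derivative p) + C (-(d * (m + 1)) : ℝ) * p := fun p ↦ by ring
  rw [e]
  ext j
  have h := coeff_succ d m j
  rcases j with _ | _ | j
  all_goals
    simp only [coeff_add, coeff_C_mul, coeff_X_mul, coeff_derivative, mul_coeff_zero,
      coeff_X_zero, coeff_C_zero, coeff_zero]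
    push_cast at h ⊢
    ring_nf at h ⊢
    linarith

lemma natDegree_eq : (jacobiPoly d m).natDegree = d := by
  refine natDegree_eq_of_le_of_coeff_ne_zero ?_ ?_
  · rw [natDegree_le_iff_coeff_eq_zero]
    intro j hj
    rw [coeff_eq, Nat.choose_eq_zero_of_lt hj]
    simp
  · rw [coeff_eq]
    have h₁ : 0 < (d + m).descFactorial m := Nat.descFactorial_pos.2 (by omega)
    have h₂ : (0 : ℝ) < (d + m).descFactorial m := by exact_mod_cast h₁
    simp only [Nat.choose_self]
    positivity

lemma leadingCoeff_ge : 1 / (d.factorial : ℝ) ≤ (jacobiPoly d m).leadingCoeff := by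
  rw [leadingCoeff, natDegree_eq, coeff_eq, Nat.choose_self]
  have h₁ : 0 < (d + m).descFactorial m := Nat.descFactorial_pos.2 (by omega)
  have h₂ : (1 : ℝ) ≤ (d + m).descFactorial m := by exact_mod_cast h₁
  gcongr
  simpa using h₂

lemma leadingCoeff_pos : 0 < (jacobiPoly d m).leadingCoeff :=
  lt_of_lt_of_le (by positivity) (leadingCoeff_ge d m)

lemma splits : (jacobiPoly d m).Splits := by
  rw [jacobiPoly, smul_eq_C_mul]
  refine (Splits.C _).mul (Splits.iterate_derivative_real ?_ _)
  refine (Splits.X.pow m).mul (Splits.pow ?_ d)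
  rw [add_comm, ← C_1]
  exact Splits.X_add_C _

lemma eval_pos {x : ℝ} (hx : 0 ≤ x) : 0 < (jacobiPoly d m).eval x := by
  rw [eval_eq_sum_range]
  refine Finset.sum_pos' (fun j _ ↦ ?_) ⟨0, by simp, ?_⟩
  · rw [coeff_eq]; positivity
  · have h₁ : 0 < (0 + m).descFactorial m := Nat.descFactorial_pos.2 (by omega)
    have h₂ : (0 : ℝ) < (0 + m).descFactorial m := by exact_mod_cast h₁
    rw [coeff_eq]
    simp only [Nat.choose_zero_right]
    positivity

lemma root_neg {x : ℝ} (hx : (jacobiPoly d m).IsRoot x) : x < 0 := by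
  by_contra! h
  exact (eval_pos d m h).ne' hx

variable {d m} {lam : ℝ}

lemma one_le_mul_neg_root (hroot : (jacobiPoly d m).IsRoot lam) :
    1 ≤ -lam * (d * (m + 1)) := by
  have hne : jacobiPoly d m ≠ 0 := leadingCoeff_ne_zero.1 (leadingCoeff_pos d m).ne'
  have h0 := eval_pos d m le_rfl
  have hlam := root_neg d m hroot
  have hsum := (splits d m).eval_derivative_eq_eval_mul_sum h0.ne'
  have hc := coeff_succ d m 0
  have h1 : (derivative (jacobiPoly d m)).eval 0 = d * (m + 1) * (jacobiPoly d m).eval 0 := by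
    rw [← coeff_zero_eq_eval_zero, ← coeff_zero_eq_eval_zero, coeff_derivative]
    push_cast at hc ⊢
    simp only [zero_add] at hc ⊢
    linarith
  have hle : 1 / (0 - lam) ≤ ((jacobiPoly d m).roots.map fun z ↦ 1 / (0 - z)).sum := by
    refine Multiset.single_le_sum ?_ _ (Multiset.mem_map_of_mem _ ((mem_roots hne).2 hroot))
    intro y hy
    obtain ⟨z, hz, rfl⟩ := Multiset.mem_map.1 hy
    have := root_neg d m ((mem_roots hne).1 hz)
    exact one_div_nonneg.2 (by linarith)
  have e : ((jacobiPoly d m).roots.map fun z : ℝ ↦ 1 / (0 - z)).sum = (d * (m + 1) : ℝ) := by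
    rw [h1] at hsum
    exact (mul_left_cancel₀ h0.ne' (by linarith)).symm
  rw [e, div_le_iff₀ (by linarith)] at hle
  linarith

lemma le_mul_max_root_add_one (hd : 1 ≤ d)
    (hmax : ∀ x : ℝ, (jacobiPoly d m).IsRoot x → x ≤ lam) :
    (m : ℝ) ≤ (lam + 1) * (d + m) := by
  have hlc := leadingCoeff_pos d m
  have hne : jacobiPoly d m ≠ 0 := leadingCoeff_ne_zero.1 hlc.ne'
  have hv := (splits d m).nextCoeff_eq_neg_sum_roots_mul_leadingCoeff
  have hcard := (splits d m).natDegree_eq_card_roots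
  rw [natDegree_eq] at hcard
  have hs : (jacobiPoly d m).roots.sum ≤ d * lam := by
    have := Multiset.sum_le_card_nsmul (jacobiPoly d m).roots lam
      fun x hx ↦ hmax x ((mem_roots hne).1 hx)
    rwa [← hcard, nsmul_eq_mul] at this
  obtain ⟨k, rfl⟩ : ∃ k, d = k + 1 := ⟨d - 1, by omega⟩
  have hc := coeff_succ (k + 1) m k
  rw [nextCoeff_of_natDegree_pos (by rw [natDegree_eq]; omega), natDegree_eq,
    Nat.add_sub_cancel] at hv
  rw [leadingCoeff, natDegree_eq] at hlc hv
  rw [hv] at hc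
  push_cast at hc hs ⊢
  have e : ((k : ℝ) + 1) ^ 2 = -(m + k + 1) * (jacobiPoly (k + 1) m).roots.sum := by
    refine mul_right_cancel₀ hlc.ne' ?_
    linear_combination hc
  have h2 : ((m : ℝ) + k + 1) * (jacobiPoly (k + 1) m).roots.sum ≤
      (m + k + 1) * ((k + 1) * lam) := by gcongr
  have hk : (0 : ℝ) < k + 1 := by positivity
  have h3 : ((k : ℝ) + 1) * (k + 1) ≥ (k + 1) * (-(m + k + 1) * lam) := by nlinarith
  have h4 : ((k : ℝ) + 1) * 0 ≤ (k + 1) * ((k + 1) + (m + k + 1) * lam) := by nlinarith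
  have := le_of_mul_le_mul_left h4 hk
  linarith

lemma sum_bound {s σ : ℝ} (hd : 2 ≤ d) (hm : 1 ≤ m)
    (h₁ : 1 ≤ s * (d * (m + 1))) (h₂ : (m : ℝ) ≤ (1 - s) * (d + m)) (hs : 0 < s) (hs' : s < 1)
    (hσ : 2 * s * (1 - s) * σ = 1 - (m + 2 - d) * s) : σ ≤ ((d : ℝ) + m) * (d - 1) := by
  have hd' : (2 : ℝ) ≤ d := by exact_mod_cast hd
  have hm' : (1 : ℝ) ≤ m := by exact_mod_cast hm
  have hss : 0 < s * (1 - s) := mul_pos hs (by linarith)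
  have key : 1 - (m + 2 - d) * s ≤ 2 * (s * (1 - s)) * (((d : ℝ) + m) * (d - 1)) := by
    have a : 1 - s ≤ (s * (1 - s)) * (d * (m + 1)) := by nlinarith
    rcases le_or_gt d (m + 1) with h | h
    · have h' : (d : ℝ) ≤ m + 1 := by exact_mod_cast h
      have b : (d : ℝ) * (m + 1) ≤ 2 * (((d : ℝ) + m) * (d - 1)) := by nlinarith
      have c := mul_le_mul_of_nonneg_left b hss.le
      nlinarith
    · have h' : (m : ℝ) + 2 ≤ d := by exact_mod_cast h
      have b : (d : ℝ) * (m + 1) ≤ ((d : ℝ) + m) * (d - 1) := by nlinarith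
      have c := mul_le_mul_of_nonneg_left b hss.le
      have e : s * (d - 1) * 1 ≤ s * (d - 1) * ((1 - s) * (d + m)) :=
        mul_le_mul_of_nonneg_left (by linarith) (mul_nonneg hs.le (by linarith))
      nlinarith
  have : 2 * (s * (1 - s)) * σ ≤ 2 * (s * (1 - s)) * (((d : ℝ) + m) * (d - 1)) := by linarith
  exact le_of_mul_le_mul_left this (by linarith)

/-- The derivative at the largest root, for every `m ≥ 1`. -/
lemma leadingCoeff_le_mul_eval_derivative (hd : 1 ≤ d) (hm : 1 ≤ m)
    (hroot : (jacobiPoly d m).IsRoot lam)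
    (hmax : ∀ x : ℝ, (jacobiPoly d m).IsRoot x → x ≤ lam) :
    (jacobiPoly d m).leadingCoeff ≤
      ((d : ℝ) + m) ^ (d - 1) * (derivative (jacobiPoly d m)).eval lam := by
  have hm' : (1 : ℝ) ≤ m := by exact_mod_cast hm
  have hlam := root_neg d m hroot
  have h₁ := one_le_mul_neg_root hroot
  have h₂ := le_mul_max_root_add_one hd hmax
  have hlam' : 0 < lam + 1 := pos_of_mul_pos_left (by linarith) (by positivity : (0:ℝ) ≤ d + m)
  have hlc := leadingCoeff_pos d m
  have hne : jacobiPoly d m ≠ 0 := leadingCoeff_ne_zero.1 hlc.ne'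
  have hode := ode d m
  have hsimple := eval_derivative_ne_zero_of_ode hne hode (x := lam)
    (by simpa using ⟨hlam.ne, by linarith⟩) hroot
  obtain ⟨Q, hQ⟩ := dvd_iff_isRoot.2 hroot
  have hsp : Q.Splits := by
    have := splits d m
    rwa [hQ, splits_X_sub_C_mul_iff] at this
  have hQlc : (jacobiPoly d m).leadingCoeff = Q.leadingCoeff := by
    rw [hQ, leadingCoeff_mul, leadingCoeff_X_sub_C, one_mul]
  have hQne : Q ≠ 0 := by rintro rfl; simp at hQ; exact hne hQ
  have hQdeg : Q.roots.card = d - 1 := by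
    have := natDegree_eq d m
    rw [hQ, natDegree_mul (X_sub_C_ne_zero _) hQne, natDegree_X_sub_C] at this
    rw [← hsp.natDegree_eq_card_roots]
    omega
  have hJ₁ : (derivative (jacobiPoly d m)).eval lam = Q.eval lam := by
    simp [hQ]
  have hJ₂ : (derivative (derivative (jacobiPoly d m))).eval lam =
      2 * (derivative Q).eval lam := by
    simp [hQ]
    ring
  rw [hJ₁] at hsimple ⊢
  have hQroot : ∀ r ∈ Q.roots, 0 < lam - r := by
    intro r hr
    have hr' := (mem_roots hQne).1 hr
    have hle : r ≤ lam := hmax r (by rw [hQ]; exact root_mul_left_of_isRoot _ hr')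
    have hne' : r ≠ lam := by rintro rfl; exact hsimple hr'
    exact sub_pos.2 (lt_of_le_of_ne hle hne')
  have hsum := hsp.eval_derivative_eq_eval_mul_sum hsimple
  set σ := (Q.roots.map fun z ↦ 1 / (lam - z)).sum with hσ
  have hσbound : σ ≤ ((d : ℝ) + m) * ((d - 1 : ℕ) : ℝ) := by
    rcases hd.eq_or_lt with rfl | hd2
    · have : Q.roots = 0 := Multiset.card_eq_zero.1 hQdeg
      simp [hσ, this]
    · rw [Nat.cast_sub hd, Nat.cast_one]
      refine sum_bound (s := -lam) hd2 hm h₁ (by linarith) (by linarith) (by linarith) ?_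
      have h := congrArg (eval lam) hode
      have hz : (jacobiPoly d m).eval lam = 0 := hroot
      simp only [eval_add, eval_mul, eval_X, eval_one, eval_C, hJ₁, hJ₂, hz, hsum,
        eval_zero] at h
      refine mul_right_cancel₀ hsimple ?_
      linear_combination -h
  have hprod := Multiset.one_le_pow_card_mul_prod (Q.roots.map fun z ↦ lam - z)
    (K := (d : ℝ) + m) (by positivity) (fun r hr ↦ by
      obtain ⟨z, hz, rfl⟩ := Multiset.mem_map.1 hr
      exact hQroot z hz)
    (by simpa [Multiset.map_map, hQdeg, hσ] using hσbound)
  rw [Multiset.card_map, hQdeg] at hprod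
  rw [hsp.eval_eq_prod_roots, hQlc]
  rw [hQlc] at hlc
  nlinarith

lemma one_le_pow_mul_eval_derivative (hd : 1 ≤ d) (hm : 2 ≤ m)
    (hroot : (jacobiPoly d m).IsRoot lam)
    (hmax : ∀ x : ℝ, (jacobiPoly d m).IsRoot x → x ≤ lam) :
    1 ≤ ((d : ℝ) + m) ^ (d * m) * (derivative (jacobiPoly d m)).eval lam := by
  have h := leadingCoeff_le_mul_eval_derivative hd (by omega) hroot hmax
  have hlc := leadingCoeff_ge d m
  have hd' : (1 : ℝ) ≤ d := by exact_mod_cast hd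
  have hfac : (d.factorial : ℝ) ≤ ((d : ℝ) + m) ^ (d - 1) := by
    have h₁ := Nat.factorial_succ_le_pow (d - 1)
    rw [Nat.sub_add_cancel hd] at h₁
    calc (d.factorial : ℝ) ≤ (d : ℝ) ^ (d - 1) := by exact_mod_cast h₁
      _ ≤ _ := by gcongr; simp
  set y := (derivative (jacobiPoly d m)).eval lam
  have hpos : 0 < ((d : ℝ) + m) ^ (d - 1) := by positivity
  have hf : (0 : ℝ) < d.factorial := by positivity
  have hy : 0 < y := pos_of_mul_pos_right ((leadingCoeff_pos d m).trans_le h) hpos.le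
  have h₁ : 1 ≤ d.factorial * (((d : ℝ) + m) ^ (d - 1) * y) := by
    rw [← div_le_iff₀' hf]
    exact hlc.trans h
  calc (1 : ℝ) ≤ ((d : ℝ) + m) ^ (d - 1) * (((d : ℝ) + m) ^ (d - 1) * y) :=
        h₁.trans (by gcongr)
    _ = ((d : ℝ) + m) ^ ((d - 1) + (d - 1)) * y := by rw [pow_add]; ring
    _ ≤ _ := by
      gcongr
      · linarith [(Nat.cast_nonneg m : (0 : ℝ) ≤ m)]
      · have : d * 2 ≤ d * m := Nat.mul_le_mul_left d hm
        omega

lemma one_le_pow_mul_eval_derivative_one (k : ℕ) (hroot : (jacobiPoly (k + 1) 1).IsRoot lam)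
    (hmax : ∀ x : ℝ, (jacobiPoly (k + 1) 1).IsRoot x → x ≤ lam) :
    1 ≤ ((k : ℝ) + 2) ^ (k + 1) * (derivative (jacobiPoly (k + 1) 1)).eval lam := by
  have hJ : jacobiPoly (k + 1) 1 =
      C (1 / ((k + 1).factorial : ℝ)) * ((1 + X) ^ k * (1 + C ((k : ℝ) + 2) * X)) := by
    rw [jacobiPoly, smul_eq_C_mul]
    congr 1
    have hC : (C ((k : ℝ) + 2) : ℝ[X]) = (k : ℝ[X]) + 2 := by simp [← C_ofNat]
    rw [hC]
    simp [derivative_pow]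
    ring
  have hk : (0 : ℝ) < k + 2 := by positivity
  have hf : (0 : ℝ) < (k + 1).factorial := by positivity
  have hlower : -1 / ((k : ℝ) + 2) ≤ lam := by
    refine hmax _ ?_
    rw [hJ, IsRoot.def]
    simp only [eval_mul, eval_add, eval_one, eval_C, eval_X]
    have : 1 + ((k : ℝ) + 2) * (-1 / (k + 2)) = 0 := by field_simp; ring
    rw [this]; ring
  have hlam1 : 0 < 1 + lam := by
    have : -1 < -1 / ((k : ℝ) + 2) := by 
      rw [lt_div_iff₀ hk]
      linarith [(Nat.cast_nonneg k : (0 : ℝ) ≤ k)]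
    linarith
  have hlin : 1 + ((k : ℝ) + 2) * lam = 0 := by
    rw [hJ, IsRoot.def] at hroot
    simp only [eval_mul, eval_add, eval_one, eval_C, eval_X, eval_pow, mul_eq_zero] at hroot
    rcases hroot with h | h | h
    · exact absurd h (by positivity)
    · exact absurd h (by positivity)
    · exact h
  have hder : (derivative (jacobiPoly (k + 1) 1)).eval lam =
      1 / ((k + 1).factorial : ℝ) * ((1 + lam) ^ k * (k + 2)) := by
    rw [hJ]
    simp only [derivative_mul, derivative_C, derivative_add, derivative_one, derivative_X,
      eval_mul, eval_add, eval_one, eval_C, eval_X, eval_pow, zero_mul, zero_add,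
      mul_one, hlin, mul_zero]
  have hl : 1 + lam = (k + 1) / (k + 2) := by field_simp; linarith
  have hfac : ((k + 1).factorial : ℝ) ≤ (k + 1) ^ k := by exact_mod_cast Nat.factorial_succ_le_pow k
  have e : ((k : ℝ) + 2) ^ (k + 1) * (1 / ((k + 1).factorial : ℝ) * ((1 + lam) ^ k * (k + 2))) =
      ((k : ℝ) + 2) ^ 2 * (((k : ℝ) + 1) ^ k / (k + 1).factorial) := by
    rw [hl, div_pow]
    field_simp
    ring
  rw [hder, e]
  refine one_le_mul_of_one_le_of_one_le ?_ ((one_le_div hf).2 hfac)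
  exact one_le_pow₀ (by linarith [(Nat.cast_nonneg k : (0:ℝ) ≤ k)])

end jacobiPoly

/-- **Sensitivity of the Jacobi root.** If `λ` is the largest root of
`J(t) = (1/d!) · D^{n-d}[t^{n-d}(1+t)^d]`, then `J'(λ) ≥ n^{-d(n-d)}`. -/
theorem jacobi_root_sensitivity (n d : ℕ) (hd : 1 ≤ d) (hnd : d < n)
    (J : Polynomial ℝ)
    (hJ : J = (1 / (d.factorial : ℝ)) •
      (Polynomial.derivative^[n - d] ((X : Polynomial ℝ) ^ (n - d) * (1 + X) ^ d)))
    (lam : ℝ) (hroot : J.IsRoot lam) (hmax : ∀ x : ℝ, J.IsRoot x → x ≤ lam) :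
    J.derivative.eval lam ≥ 1 / (n : ℝ) ^ (d * (n - d)) := by
  obtain ⟨m, rfl⟩ : ∃ m, n = d + m := ⟨n - d, by omega⟩
  rw [Nat.add_sub_cancel_left] at hJ ⊢
  replace hJ : J = jacobiPoly d m := hJ
  subst hJ
  rw [ge_iff_le, div_le_iff₀' (by positivity)]
  rcases (show 1 ≤ m by omega).eq_or_lt with rfl | hm
  · obtain ⟨k, rfl⟩ : ∃ k, d = k + 1 := ⟨d - 1, by omega⟩
    have h := jacobiPoly.one_le_pow_mul_eval_derivative_one k hroot hmax
    have e : ((k + 1 + 1 : ℕ) : ℝ) = (k : ℝ) + 2 := by push_cast; ring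
    rwa [e, mul_one]
  · have h := jacobiPoly.one_le_pow_mul_eval_derivative hd hm hroot hmax
    rwa [← Nat.cast_add] at h
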